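/- arXiv:1803.04959 — 6 statements merged into one kernel-verified Lean document; each statement's English description precedes it below -/
import Mathlib

section
/- Let φ ∈ ℝ^m be a probability vector with φ_i > 0 for all i, and define the cumulant generating function Λ(x) := log(Σ_{i=1}^m φ_i e^{x_i}) for x ∈ ℝ^m. Then the Legendre–Fenchel transform Λ*(f) := sup_{x∈ℝ^m}(Σ_{i=1}^m x_i f_i − Λ(x)) satisfies: (i) if f is a probability vector (f_i ≥ 0 for all i and Σ_i f_i = 1), then Λ*(f) = D_KL(f‖φ) = Σ_{i=1}^m f_i log(f_i/φ_i); (ii) if f is not a probability vector (some f_i < 0 or Σ_i f_i ≠ 1), then Λ*(f) = +∞. -/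
/-- The cumulant generating function `Λ(x) = log (Σ_i φ_i e^{x_i})`. -/
noncomputable def Lam {m : ℕ} (φ x : Fin m → ℝ) : ℝ :=
  Real.log (∑ i, φ i * Real.exp (x i))

/-- The Legendre–Fenchel transform `Λ*(f) = sup_x (⟨x, f⟩ - Λ(x))`, valued in `EReal`. -/
noncomputable def LamStar {m : ℕ} (φ f : Fin m → ℝ) : EReal :=
  ⨆ x : Fin m → ℝ, ((∑ i, x i * f i - Lam φ x : ℝ) : EReal)

/-- The Kullback–Leibler divergence `D_KL(f‖φ) = Σ_i f_i log (f_i / φ_i)`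
(with the convention `0 · log 0 = 0`, which holds since `Real.log 0 = 0`). -/
noncomputable def KLdiv {m : ℕ} (f φ : Fin m → ℝ) : ℝ :=
  ∑ i, f i * Real.log (f i / φ i)

theorem LamStar_aux_top {m : ℕ} (φ f : Fin m → ℝ)
    (h : ∀ y : ℝ, ∃ x : Fin m → ℝ, y < ∑ i, x i * f i - Lam φ x) : LamStar φ f = ⊤ := by
  rw [EReal.eq_top_iff_forall_lt]
  intro y
  obtain ⟨x, hx⟩ := h y
  refine lt_of_lt_of_le (EReal.coe_lt_coe_iff.2 hx) ?_
  exact le_iSup (fun x : Fin m → ℝ => ((∑ i, x i * f i - Lam φ x : ℝ) : EReal)) x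

theorem LamStar_aux_upper {m : ℕ} (hm : 0 < m) (φ f x : Fin m → ℝ) (hφpos : ∀ i, 0 < φ i)
    (hf : ∀ i, 0 ≤ f i) (hs : ∑ i, f i = 1) :
    ∑ i, x i * f i - Lam φ x ≤ KLdiv f φ := by
  have hZ : 0 < ∑ i, φ i * Real.exp (x i) :=
    Finset.sum_pos (fun i _ => mul_pos (hφpos i) (Real.exp_pos _)) ⟨⟨0, hm⟩, Finset.mem_univ _⟩
  unfold Lam KLdiv
  set Z := ∑ i, φ i * Real.exp (x i) with hZdef
  have key : ∀ i, x i * f i - f i * Real.log Z - f i * Real.log (f i / φ i)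
      ≤ φ i * Real.exp (x i) / Z - f i := by
    intro i
    rcases (hf i).eq_or_lt with h0 | h0
    · rw [← h0]
      have := div_pos (mul_pos (hφpos i) (Real.exp_pos (x i))) hZ
      simp
      exact this.le
    · have hq := div_pos (mul_pos (hφpos i) (Real.exp_pos (x i))) hZ
      have h1 := Real.log_le_sub_one_of_pos (div_pos hq h0)
      have h2 := mul_le_mul_of_nonneg_left h1 h0.le
      rw [Real.log_div hq.ne' h0.ne', Real.log_div (mul_pos (hφpos i) (Real.exp_pos (x i))).ne' hZ.ne',
        Real.log_mul (hφpos i).ne' (Real.exp_pos _).ne', Real.log_exp, mul_sub (f i) (_ / _) 1,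
        mul_div_cancel₀ _ h0.ne'] at h2
      rw [Real.log_div h0.ne' (hφpos i).ne']
      linarith
  have hsum := Finset.sum_le_sum (fun i (_ : i ∈ Finset.univ) => key i)
  simp only [Finset.sum_sub_distrib] at hsum
  rw [← Finset.sum_mul, ← Finset.sum_div, ← hZdef, hs, div_self hZ.ne'] at hsum
  linarith

theorem LamStar_aux_lower {m : ℕ} (hm : 0 < m) (φ f : Fin m → ℝ) (hφpos : ∀ i, 0 < φ i)
    (hφsum : ∑ i, φ i = 1) (hf : ∀ i, 0 ≤ f i) (hs : ∑ i, f i = 1) (t : ℝ) :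
    ∃ x : Fin m → ℝ, KLdiv f φ - Real.exp (-t) ≤ ∑ i, x i * f i - Lam φ x := by
  refine ⟨fun i => if f i = 0 then -t else Real.log (f i / φ i), ?_⟩
  set x : Fin m → ℝ := fun i => if f i = 0 then -t else Real.log (f i / φ i) with hx
  have hZ : 0 < ∑ i, φ i * Real.exp (x i) :=
    Finset.sum_pos (fun i _ => mul_pos (hφpos i) (Real.exp_pos _)) ⟨⟨0, hm⟩, Finset.mem_univ _⟩
  have h1 : ∑ i, x i * f i = KLdiv f φ := by
    unfold KLdiv
    refine Finset.sum_congr rfl fun i _ => ?_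
    by_cases h : f i = 0
    · simp [h]
    · simp [hx, h, mul_comm]
  have h2 : ∑ i, φ i * Real.exp (x i) ≤ ∑ i, (f i + φ i * Real.exp (-t)) := by
    refine Finset.sum_le_sum fun i _ => ?_
    by_cases h : f i = 0
    · simp [hx, h]
    · have hp : 0 < f i := lt_of_le_of_ne (hf i) (Ne.symm h)
      simp only [hx, h, if_false]
      rw [Real.exp_log (div_pos hp (hφpos i)), mul_div_cancel₀ _ (hφpos i).ne']
      have := mul_pos (hφpos i) (Real.exp_pos (-t))
      linarith
  rw [Finset.sum_add_distrib, ← Finset.sum_mul, hs, hφsum] at h2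
  have h3 := Real.log_le_sub_one_of_pos hZ
  rw [h1]
  unfold Lam
  linarith

/-- The Legendre–Fenchel transform of the cumulant generating function equals the KL
divergence on probability vectors, and is `+∞` off the probability simplex. -/
theorem stmt_6 (m : ℕ) (hm : 0 < m) (φ : Fin m → ℝ)
    (hφpos : ∀ i, 0 < φ i) (hφsum : ∑ i, φ i = 1)
    (f : Fin m → ℝ) :
    ((∀ i, 0 ≤ f i) ∧ ∑ i, f i = 1 → LamStar φ f = (KLdiv f φ : EReal)) ∧
    (¬ ((∀ i, 0 ≤ f i) ∧ ∑ i, f i = 1) → LamStar φ f = ⊤) := by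
  constructor
  · rintro ⟨hf, hs⟩
    apply le_antisymm
    · exact iSup_le fun x => EReal.coe_le_coe_iff.2 (LamStar_aux_upper hm φ f x hφpos hf hs)
    · have hlim : Filter.Tendsto (fun t : ℝ => ((KLdiv f φ - Real.exp (-t) : ℝ) : EReal))
          Filter.atTop (nhds (KLdiv f φ : EReal)) := by
        have h0 : Filter.Tendsto (fun t : ℝ => KLdiv f φ - Real.exp (-t)) Filter.atTop
            (nhds (KLdiv f φ - 0)) :=
          tendsto_const_nhds.sub Real.tendsto_exp_neg_atTop_nhds_zero
        rw [sub_zero] at h0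
        exact (continuous_coe_real_ereal.tendsto _).comp h0
      refine le_of_tendsto' hlim fun t => ?_
      obtain ⟨x, hx⟩ := LamStar_aux_lower hm φ f hφpos hφsum hf hs t
      refine (EReal.coe_le_coe_iff.2 hx).trans ?_
      exact le_iSup (fun x : Fin m → ℝ => ((∑ i, x i * f i - Lam φ x : ℝ) : EReal)) x
  · intro h
    apply LamStar_aux_top
    intro y
    by_cases hf : ∀ i, 0 ≤ f i
    · have hs : ∑ i, f i - 1 ≠ 0 := fun hs => h ⟨hf, sub_eq_zero.1 hs⟩
      refine ⟨fun _ => (y + 1) / (∑ i, f i - 1), ?_⟩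
      unfold Lam
      rw [← Finset.sum_mul, ← Finset.mul_sum, hφsum, one_mul, Real.log_exp]
      have : (y + 1) / (∑ i, f i - 1) * ∑ i, f i - (y + 1) / (∑ i, f i - 1) = y + 1 := by
        rw [← mul_sub_one, div_mul_cancel₀ _ hs]
      linarith
    · push Not at hf
      obtain ⟨j, hj⟩ := hf
      have ht : 0 ≤ (|y| + 1) / (- f j) := div_nonneg (by positivity) (by linarith)
      refine ⟨fun i => if i = j then -((|y| + 1) / (- f j)) else 0, ?_⟩
      set t := (|y| + 1) / (- f j) with htdef
      have h1 : ∑ i, (if i = j then -t else 0) * f i = |y| + 1 := by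
        simp only [ite_mul, zero_mul, Finset.sum_ite_eq', Finset.mem_univ, if_true]
        rw [htdef]
        field_simp [hj.ne]
      have h2 : Lam φ (fun i => if i = j then -t else 0) ≤ 0 := by
        unfold Lam
        apply Real.log_nonpos
        · exact Finset.sum_nonneg fun i _ => mul_nonneg (hφpos i).le (Real.exp_pos _).le
        · rw [← hφsum]
          refine Finset.sum_le_sum fun i _ => ?_
          refine mul_le_of_le_one_right (hφpos i).le (Real.exp_le_one_iff.2 ?_)
          dsimp only; split_ifs <;> linarith
      rw [h1]
      have := le_abs_self y
      linarith
end

section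
/- Let J ⊆ V_D be such that λ_J > μ_J > 0. Then for every probability matrix f, D_KL(f‖φ) ≥ log(λ_J/μ_J) · drift_J(f). -/
open Finset

/-- The supply-node neighborhood `∂(J) = ⋃_{j' ∈ J} ∂(j')` of a set `J` of demand nodes. -/
def nbhd {VD VS : Type} [DecidableEq VS] (Nb : VD → Finset VS) (J : Finset VD) : Finset VS :=
  J.biUnion Nb

/-- `λ_J = Σ_{j' ∉ J} Σ_{k ∈ ∂(J)} φ_{j'k}`. -/
def lamJ {VD VS : Type} [Fintype VD] [DecidableEq VD] [DecidableEq VS]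
    (Nb : VD → Finset VS) (φ : VD → VS → ℝ) (J : Finset VD) : ℝ :=
  ∑ j' ∈ Jᶜ, ∑ k ∈ nbhd Nb J, φ j' k

/-- `μ_J = Σ_{j' ∈ J} Σ_{k ∉ ∂(J)} φ_{j'k}`. -/
def muJ {VD VS : Type} [Fintype VS] [DecidableEq VS]
    (Nb : VD → Finset VS) (φ : VD → VS → ℝ) (J : Finset VD) : ℝ :=
  ∑ j' ∈ J, ∑ k ∈ (nbhd Nb J)ᶜ, φ j' k

/-- `drift_J(f) = Σ_{j'∈J} Σ_{k∈V_S} f_{j'k} − Σ_{j'∈V_D} Σ_{k∈∂(J)} f_{j'k}`. -/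
def driftJ {VD VS : Type} [Fintype VD] [Fintype VS] [DecidableEq VS]
    (Nb : VD → Finset VS) (f : VD → VS → ℝ) (J : Finset VD) : ℝ :=
  ∑ j' ∈ J, ∑ k : VS, f j' k - ∑ j' : VD, ∑ k ∈ nbhd Nb J, f j' k

/-- KL divergence of matrices, real-valued part (conventions `0 log 0 = 0` hold since
`Real.log 0 = 0`). -/
noncomputable def KLmat {VD VS : Type} [Fintype VD] [Fintype VS] (f φ : VD → VS → ℝ) : ℝ :=
  ∑ j' : VD, ∑ k : VS, f j' k * Real.log (f j' k / φ j' k)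

open scoped Classical in
/-- KL divergence of matrices valued in `EReal`, with the convention that
`D_KL(f‖φ) = +∞` if `f` is not absolutely continuous with respect to `φ`. -/
noncomputable def KLe {VD VS : Type} [Fintype VD] [Fintype VS] (f φ : VD → VS → ℝ) : EReal :=
  if ∀ j' k, φ j' k = 0 → f j' k = 0 then ((KLmat f φ : ℝ) : EReal) else ⊤

theorem kl_pointwise (f p t : ℝ) (hf : 0 ≤ f) (hp : 0 ≤ p) (h : p = 0 → f = 0) :
    t * f + (f - p * Real.exp t) ≤ f * Real.log (f / p) := by
  rcases hf.eq_or_lt with h0 | h0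
  · subst h0
    have := mul_nonneg hp (Real.exp_pos t).le
    simp only [zero_mul, mul_zero]
    linarith
  · have hp' : 0 < p := lt_of_le_of_ne hp (fun e => h0.ne' (h e.symm))
    have h1 := Real.log_le_sub_one_of_pos (x := p * Real.exp t / f) (by positivity)
    rw [Real.log_div (by positivity) h0.ne', Real.log_mul hp'.ne' (Real.exp_pos t).ne',
      Real.log_exp] at h1
    rw [Real.log_div h0.ne' hp'.ne']
    have h2 := mul_le_mul_of_nonneg_left h1 hf
    have h3 : f * (p * Real.exp t / f - 1) = p * Real.exp t - f := by
      field_simp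
    rw [h3] at h2
    linarith

/-- If `λ_J > μ_J > 0` then for every probability matrix `f`,
`D_KL(f‖φ) ≥ log(λ_J/μ_J) · drift_J(f)`. -/
theorem stmt_8 {VD VS : Type} [Fintype VD] [Fintype VS] [DecidableEq VD] [DecidableEq VS]
    (Nb : VD → Finset VS) (φ : VD → VS → ℝ)
    (hφ0 : ∀ j' k, 0 ≤ φ j' k) (hφsum : ∑ j' : VD, ∑ k : VS, φ j' k = 1)
    (J : Finset VD) (hμ : 0 < muJ Nb φ J) (hlm : muJ Nb φ J < lamJ Nb φ J)
    (f : VD → VS → ℝ) (hf0 : ∀ j' k, 0 ≤ f j' k)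
    (hfsum : ∑ j' : VD, ∑ k : VS, f j' k = 1) :
    ((Real.log (lamJ Nb φ J / muJ Nb φ J) * driftJ Nb f J : ℝ) : EReal) ≤ KLe f φ := by
  unfold KLe
  split_ifs with hac
  swap
  · exact le_top
  rw [EReal.coe_le_coe_iff]
  have hlam : 0 < lamJ Nb φ J := hμ.trans hlm
  set lam := lamJ Nb φ J with hlamdef
  set mu := muJ Nb φ J with hmudef
  set L := Real.log (lam / mu) with hL
  have hexp : Real.exp L = lam / mu := Real.exp_log (by positivity)
  have hexpn : Real.exp (-L) = mu / lam := by rw [Real.exp_neg, hexp, inv_div]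
  set N := nbhd Nb J with hN
  let w : VD → VS → ℝ := fun j k => (if j ∈ J then 1 else 0) - (if k ∈ N then 1 else 0)
  have hdrift : driftJ Nb f J = ∑ j, ∑ k, w j k * f j k := by
    simp only [driftJ, w, sub_mul, Finset.sum_sub_distrib, ite_mul, one_mul, zero_mul,
      Finset.sum_ite_mem, Finset.univ_inter, ← hN]
    congr 1
    rw [← Finset.sum_subset (Finset.subset_univ J)]
    · exact Finset.sum_congr rfl fun j hj => by simp [hj]
    · intro j _ hj
      simp [hj]
  have hlam' : lam = ∑ j, ∑ k, (if j ∈ J then 0 else if k ∈ N then φ j k else 0) := by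
    rw [hlamdef, lamJ, ← Finset.sum_subset (Finset.subset_univ Jᶜ)]
    · refine Finset.sum_congr rfl fun j hj => ?_
      rw [Finset.mem_compl] at hj
      simp [hj, Finset.sum_ite_mem, ← hN]
    · intro j _ hj
      rw [Finset.mem_compl, not_not] at hj
      simp [hj]
  have hmu' : mu = ∑ j, ∑ k, (if j ∈ J then if k ∈ N then 0 else φ j k else 0) := by
    rw [hmudef, muJ, ← Finset.sum_subset (Finset.subset_univ J)]
    · refine Finset.sum_congr rfl fun j hj => ?_
      rw [← Finset.sum_subset (Finset.subset_univ (nbhd Nb J)ᶜ)]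
      · refine Finset.sum_congr rfl fun k hk => ?_
        rw [Finset.mem_compl, ← hN] at hk
        simp [hj, hk]
      · intro k _ hk
        rw [Finset.mem_compl, not_not, ← hN] at hk
        simp [hk]
    · intro j _ hj
      simp [hj]
  have hsum : ∑ j, ∑ k, φ j k * Real.exp (L * w j k) = 1 := by
    have : ∀ j k, φ j k * Real.exp (L * w j k) = φ j k
        + (mu / lam - 1) * (if j ∈ J then 0 else if k ∈ N then φ j k else 0)
        + (lam / mu - 1) * (if j ∈ J then if k ∈ N then 0 else φ j k else 0) := by
      intro j k
      by_cases hj : j ∈ J <;> by_cases hk : k ∈ N <;> simp [w, hj, hk, hexp, hexpn] <;> ring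
    simp only [this, Finset.sum_add_distrib, ← Finset.mul_sum]
    rw [← hlam', ← hmu', hφsum]
    field_simp
    ring
  have key : ∑ j, ∑ k, (L * w j k * f j k + (f j k - φ j k * Real.exp (L * w j k)))
      ≤ KLmat f φ :=
    Finset.sum_le_sum fun j _ => Finset.sum_le_sum fun k _ =>
      kl_pointwise _ _ _ (hf0 j k) (hφ0 j k) (hac j k)
  simp only [Finset.sum_add_distrib, Finset.sum_sub_distrib, hsum, hfsum, mul_assoc,
    ← Finset.mul_sum] at key
  rw [hdrift]
  linarith
end

section
/- Let J ⊆ V_D be such that λ_J > 0 and μ_J > 0, and define the tilted matrix f* by f*_{j'k} := φ_{j'k}·(λ_J/μ_J) if j' ∈ J and k ∉ ∂(J); f*_{j'k} := φ_{j'k}·(μ_J/λ_J) if j' ∉ J and k ∈ ∂(J); and f*_{j'k} := φ_{j'k} otherwise. Then: (i) f* is a probability matrix; (ii) drift_J(f*) = λ_J − μ_J; and (iii) D_KL(f*‖φ) = (λ_J − μ_J)·log(λ_J/μ_J). -/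
open Finset

/-- The tilted matrix `f*` associated with `J`. -/
noncomputable def tiltMat {VD VS : Type} [Fintype VD] [Fintype VS] [DecidableEq VD]
    [DecidableEq VS] (Nb : VD → Finset VS) (φ : VD → VS → ℝ) (J : Finset VD) :
    VD → VS → ℝ := fun j' k =>
  if j' ∈ J ∧ k ∉ nbhd Nb J then φ j' k * (lamJ Nb φ J / muJ Nb φ J)
  else if j' ∉ J ∧ k ∈ nbhd Nb J then φ j' k * (muJ Nb φ J / lamJ Nb φ J)
  else φ j' k

theorem sum_blocks {VD VS : Type} [Fintype VD] [Fintype VS] [DecidableEq VD] [DecidableEq VS]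
    (J : Finset VD) (N : Finset VS) (g : VD → VS → ℝ) :
    ∑ j, ∑ k, g j k = (∑ j ∈ J, ∑ k ∈ N, g j k + ∑ j ∈ J, ∑ k ∈ Nᶜ, g j k)
      + (∑ j ∈ Jᶜ, ∑ k ∈ N, g j k + ∑ j ∈ Jᶜ, ∑ k ∈ Nᶜ, g j k) := by
  rw [← Finset.sum_add_sum_compl J, ← Finset.sum_add_distrib, ← Finset.sum_add_distrib]
  congr 1 <;> exact Finset.sum_congr rfl fun j _ => (Finset.sum_add_sum_compl N _).symm

/-- Properties of the tilted matrix `f*`: it is a probability matrix,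
`drift_J(f*) = λ_J − μ_J`, and `D_KL(f*‖φ) = (λ_J − μ_J)·log(λ_J/μ_J)`. -/
theorem stmt_9 {VD VS : Type} [Fintype VD] [Fintype VS] [DecidableEq VD] [DecidableEq VS]
    (Nb : VD → Finset VS) (φ : VD → VS → ℝ)
    (hφ0 : ∀ j' k, 0 ≤ φ j' k) (hφsum : ∑ j' : VD, ∑ k : VS, φ j' k = 1)
    (J : Finset VD) (hlam : 0 < lamJ Nb φ J) (hmu : 0 < muJ Nb φ J) :
    (∀ j' k, 0 ≤ tiltMat Nb φ J j' k) ∧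
    (∑ j' : VD, ∑ k : VS, tiltMat Nb φ J j' k = 1) ∧
    driftJ Nb (tiltMat Nb φ J) J = lamJ Nb φ J - muJ Nb φ J ∧
    KLe (tiltMat Nb φ J) φ =
      (((lamJ Nb φ J - muJ Nb φ J) * Real.log (lamJ Nb φ J / muJ Nb φ J) : ℝ) : EReal) := by
  have hl := hlam.ne'
  have hm := hmu.ne'
  have h11 : ∀ j ∈ J, ∀ k ∈ nbhd Nb J, tiltMat Nb φ J j k = φ j k := by
    intro j hj k hk; simp [tiltMat, hj, hk]
  have h12 : ∀ j ∈ J, ∀ k ∈ (nbhd Nb J)ᶜ,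
      tiltMat Nb φ J j k = φ j k * (lamJ Nb φ J / muJ Nb φ J) := by
    intro j hj k hk; simp [tiltMat, hj, Finset.mem_compl.1 hk]
  have h21 : ∀ j ∈ Jᶜ, ∀ k ∈ nbhd Nb J,
      tiltMat Nb φ J j k = φ j k * (muJ Nb φ J / lamJ Nb φ J) := by
    intro j hj k hk; simp [tiltMat, Finset.mem_compl.1 hj, hk]
  have h22 : ∀ j ∈ Jᶜ, ∀ k ∈ (nbhd Nb J)ᶜ, tiltMat Nb φ J j k = φ j k := by
    intro j hj k hk; simp [tiltMat, Finset.mem_compl.1 hj, Finset.mem_compl.1 hk]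
  have s11 := Finset.sum_congr rfl fun j hj => Finset.sum_congr rfl (h11 j hj)
  have s22 := Finset.sum_congr rfl fun j hj => Finset.sum_congr rfl (h22 j hj)
  have s12 : ∑ j ∈ J, ∑ k ∈ (nbhd Nb J)ᶜ, tiltMat Nb φ J j k = lamJ Nb φ J := by
    rw [Finset.sum_congr rfl fun j hj => Finset.sum_congr rfl (h12 j hj)]
    simp only [← Finset.sum_mul]
    change muJ Nb φ J * _ = _
    field_simp
  have s21 : ∑ j ∈ Jᶜ, ∑ k ∈ nbhd Nb J, tiltMat Nb φ J j k = muJ Nb φ J := by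
    rw [Finset.sum_congr rfl fun j hj => Finset.sum_congr rfl (h21 j hj)]
    simp only [← Finset.sum_mul]
    change lamJ Nb φ J * _ = _
    field_simp
  refine ⟨?_, ?_, ?_, ?_⟩
  · intro j k
    have := hφ0 j k
    unfold tiltMat
    split_ifs <;> positivity
  · rw [sum_blocks J (nbhd Nb J)] at hφsum ⊢
    rw [s11, s12, s21, s22]
    have e1 : ∑ j ∈ J, ∑ k ∈ (nbhd Nb J)ᶜ, φ j k = muJ Nb φ J := rfl
    have e2 : ∑ j ∈ Jᶜ, ∑ k ∈ nbhd Nb J, φ j k = lamJ Nb φ J := rfl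
    rw [e1, e2] at hφsum
    linarith
  · unfold driftJ
    rw [← Finset.sum_add_sum_compl J (fun j => ∑ k ∈ nbhd Nb J, tiltMat Nb φ J j k), s21,
      Finset.sum_congr rfl fun j _ => (Finset.sum_add_sum_compl (nbhd Nb J) _).symm,
      Finset.sum_add_distrib, s12]
    ring
  · have hac : ∀ j k, φ j k = 0 → tiltMat Nb φ J j k = 0 := by
      intro j k h
      simp [tiltMat, h]
    have key : ∀ j k (c : ℝ), tiltMat Nb φ J j k = φ j k * c →
        tiltMat Nb φ J j k * Real.log (tiltMat Nb φ J j k / φ j k)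
          = tiltMat Nb φ J j k * Real.log c := by
      intro j k c h
      by_cases h0 : φ j k = 0
      · simp [hac j k h0]
      · rw [h, mul_div_cancel_left₀ _ h0]
    rw [KLe, if_pos hac]
    congr 1
    rw [KLmat, sum_blocks J (nbhd Nb J),
      Finset.sum_congr rfl fun j hj => Finset.sum_congr rfl fun k hk =>
        key j k 1 (by rw [h11 j hj k hk, mul_one]),
      Finset.sum_congr (s₁ := J) rfl fun j hj => Finset.sum_congr (s₁ := (nbhd Nb J)ᶜ) rfl
        fun k hk => key j k _ (h12 j hj k hk),
      Finset.sum_congr (s₁ := Jᶜ) rfl fun j hj => Finset.sum_congr (s₁ := nbhd Nb J) rfl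
        fun k hk => key j k _ (h21 j hj k hk),
      Finset.sum_congr (s₁ := Jᶜ) rfl fun j hj => Finset.sum_congr (s₁ := (nbhd Nb J)ᶜ) rfl
        fun k hk => key j k 1 (by rw [h22 j hj k hk, mul_one])]
    simp only [← Finset.sum_mul]
    rw [s12, s21, Real.log_one, Real.log_div hl hm, Real.log_div hm hl]
    ring
end

section
/- Let J ⊆ V_D be such that λ_J > μ_J > 0. Then the infimum, over all probability matrices f with drift_J(f) > 0, of D_KL(f‖φ)/drift_J(f) equals log(λ_J/μ_J); moreover this infimum is attained at the tilted matrix f* defined by f*_{j'k} := φ_{j'k}·(λ_J/μ_J) if j' ∈ J and k ∉ ∂(J), f*_{j'k} := φ_{j'k}·(μ_J/λ_J) if j' ∉ J and k ∈ ∂(J), and f*_{j'k} := φ_{j'k} otherwise. -/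
open Finset

noncomputable def sgnJ {VD VS : Type} [DecidableEq VD] [DecidableEq VS]
    (N : Finset VS) (J : Finset VD) (j : VD) (k : VS) : ℝ :=
  (if j ∈ J then 1 else 0) - (if k ∈ N then 1 else 0)

lemma drift_eq {VD VS : Type} [Fintype VD] [Fintype VS] [DecidableEq VD] [DecidableEq VS]
    (Nb : VD → Finset VS) (f : VD → VS → ℝ) (J : Finset VD) :
    driftJ Nb f J = ∑ j : VD, ∑ k : VS, f j k * sgnJ (nbhd Nb J) J j k := by
  unfold driftJ sgnJ
  simp only [mul_sub, Finset.sum_sub_distrib, mul_ite, mul_one, mul_zero]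
  congr 1
  · rw [← Finset.sum_filter_add_sum_filter_not Finset.univ (fun j => j ∈ J)]
    rw [Finset.sum_eq_zero (s := Finset.univ.filter (fun j => ¬ j ∈ J)), add_zero]
    · have : Finset.univ.filter (fun j => j ∈ J) = J := by ext; simp
      rw [this]
      exact Finset.sum_congr rfl fun j hj => by simp [hj]
    · intro j hj
      have : j ∉ J := by simpa using hj
      simp [this]
  · exact Finset.sum_congr rfl fun j _ => by simp [Finset.sum_ite_mem]

lemma rect_eq {VD VS : Type} [Fintype VD] [Fintype VS] [DecidableEq VD] [DecidableEq VS]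
    (A : Finset VD) (B : Finset VS) (f : VD → VS → ℝ) :
    ∑ j ∈ A, ∑ k ∈ B, f j k =
      ∑ j : VD, ∑ k : VS, f j k * ((if j ∈ A then 1 else 0) * (if k ∈ B then 1 else 0)) := by
  have h : ∀ j, ∑ k : VS, f j k * ((if j ∈ A then 1 else 0) * (if k ∈ B then 1 else 0))
      = if j ∈ A then ∑ k ∈ B, f j k else 0 := by
    intro j
    by_cases hj : j ∈ A <;> simp [hj, Finset.sum_ite_mem]
  simp only [h, Finset.sum_ite_mem, Finset.univ_inter]

/-- If `λ_J > μ_J > 0` then the infimum over probability matrices `f` with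
`drift_J(f) > 0` of `D_KL(f‖φ)/drift_J(f)` equals `log(λ_J/μ_J)` (it is in fact a
minimum, i.e. `IsLeast`), and it is attained at the tilted matrix `f*`. -/
theorem stmt_10 {VD VS : Type} [Fintype VD] [Fintype VS] [DecidableEq VD] [DecidableEq VS]
    (Nb : VD → Finset VS) (φ : VD → VS → ℝ)
    (hφ0 : ∀ j' k, 0 ≤ φ j' k) (hφsum : ∑ j' : VD, ∑ k : VS, φ j' k = 1)
    (J : Finset VD) (hmu : 0 < muJ Nb φ J) (hlm : muJ Nb φ J < lamJ Nb φ J) :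
    IsLeast {y : EReal | ∃ f : VD → VS → ℝ, (∀ j' k, 0 ≤ f j' k) ∧
        (∑ j' : VD, ∑ k : VS, f j' k = 1) ∧ 0 < driftJ Nb f J ∧
        y = KLe f φ / ((driftJ Nb f J : ℝ) : EReal)}
      ((Real.log (lamJ Nb φ J / muJ Nb φ J) : ℝ) : EReal) ∧
    ((∀ j' k, 0 ≤ tiltMat Nb φ J j' k) ∧
      (∑ j' : VD, ∑ k : VS, tiltMat Nb φ J j' k = 1) ∧
      0 < driftJ Nb (tiltMat Nb φ J) J ∧
      KLe (tiltMat Nb φ J) φ / ((driftJ Nb (tiltMat Nb φ J) J : ℝ) : EReal) =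
        ((Real.log (lamJ Nb φ J / muJ Nb φ J) : ℝ) : EReal)) := by
  have hlam : 0 < lamJ Nb φ J := hmu.trans hlm
  have hmuE : muJ Nb φ J = _ := rect_eq J (nbhd Nb J)ᶜ φ
  have hlamE : lamJ Nb φ J = _ := rect_eq Jᶜ (nbhd Nb J) φ
  have htdef : tiltMat Nb φ J = fun j' k =>
      if j' ∈ J ∧ k ∉ nbhd Nb J then φ j' k * (lamJ Nb φ J / muJ Nb φ J)
      else if j' ∉ J ∧ k ∈ nbhd Nb J then φ j' k * (muJ Nb φ J / lamJ Nb φ J)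
      else φ j' k := rfl
  set m := muJ Nb φ J with hm
  set l := lamJ Nb φ J with hl
  set t := tiltMat Nb φ J with ht
  set N := nbhd Nb J with hN
  clear_value m l t
  set L := Real.log (l / m) with hL
  have hlmpos : 0 < l / m := div_pos hlam hmu
  have hmlpos : 0 < m / l := div_pos hmu hlam
  have hLinv : Real.log (m / l) = - L := by
    rw [hL, ← Real.log_inv, inv_div]
  have htexp : ∀ j k, t j k = φ j k * Real.exp (L * sgnJ N J j k) := by
    intro j k
    rw [htdef]
    unfold sgnJ
    by_cases hj : j ∈ J <;> by_cases hk : k ∈ N <;> simp [hj, hk]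
    · left; rw [hL, Real.exp_log hlmpos]
    · left; rw [← hLinv, Real.exp_log hmlpos]
  have htsplit : ∀ j k, t j k = φ j k
      + (l / m - 1) * (φ j k * ((if j ∈ J then 1 else 0) * (if k ∈ Nᶜ then 1 else 0)))
      + (m / l - 1) * (φ j k * ((if j ∈ Jᶜ then 1 else 0) * (if k ∈ N then 1 else 0))) := by
    intro j k
    rw [htdef]
    by_cases hj : j ∈ J <;> by_cases hk : k ∈ N <;> simp [hj, hk] <;> ring
  have htdrift : ∀ j k, t j k * sgnJ N J j k =
      (l / m) * (φ j k * ((if j ∈ J then 1 else 0) * (if k ∈ Nᶜ then 1 else 0)))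
      - (m / l) * (φ j k * ((if j ∈ Jᶜ then 1 else 0) * (if k ∈ N then 1 else 0))) := by
    intro j k
    rw [htdef]
    unfold sgnJ
    by_cases hj : j ∈ J <;> by_cases hk : k ∈ N <;> simp [hj, hk] <;> ring
  have ht0 : ∀ j k, 0 ≤ t j k := fun j k => by
    rw [htexp]; exact mul_nonneg (hφ0 j k) (Real.exp_pos _).le
  have htsum : ∑ j : VD, ∑ k : VS, t j k = 1 := by
    simp only [htsplit, Finset.sum_add_distrib, ← Finset.mul_sum]
    rw [← hmuE, ← hlamE, hφsum]
    field_simp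
    ring
  have htd : driftJ Nb t J = l - m := by
    rw [drift_eq]
    simp only [← hN, htdrift, Finset.sum_sub_distrib, ← Finset.mul_sum]
    rw [← hmuE, ← hlamE]
    field_simp
  have htdpos : 0 < driftJ Nb t J := by rw [htd]; linarith
  have htKL : KLe t φ = ((L * driftJ Nb t J : ℝ) : EReal) := by
    unfold KLe
    rw [if_pos (fun j k h => by rw [htexp, h, zero_mul])]
    congr 1
    rw [drift_eq, KLmat, Finset.mul_sum]
    refine Finset.sum_congr rfl fun j _ => ?_
    rw [Finset.mul_sum]
    refine Finset.sum_congr rfl fun k _ => ?_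
    rcases (hφ0 j k).eq_or_lt with h | h
    · simp [htexp, ← h]
    · have : t j k / φ j k = Real.exp (L * sgnJ N J j k) := by
        rw [htexp]; field_simp
      rw [this, Real.log_exp]; ring
  have htval : KLe t φ / ((driftJ Nb t J : ℝ) : EReal) = (L : EReal) := by
    rw [htKL, ← EReal.coe_div, mul_div_cancel_right₀ _ htdpos.ne']
  refine ⟨⟨⟨t, ht0, htsum, htdpos, htval.symm⟩, ?_⟩, ht0, htsum, htdpos, htval⟩
  rintro y ⟨f, hf0, hfsum, hfd, rfl⟩
  unfold KLe
  split_ifs with hac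
  · rw [← EReal.coe_div, EReal.coe_le_coe_iff, le_div_iff₀ hfd]
    have key : ∀ j k, L * (f j k * sgnJ N J j k) + (f j k - t j k)
        ≤ f j k * Real.log (f j k / φ j k) := by
      intro j k
      rcases (hf0 j k).eq_or_lt with h | h
      · simp [← h, ht0]
      · have hp : 0 < φ j k := (hφ0 j k).lt_of_ne fun e => h.ne' (hac j k e.symm)
        have htp : 0 < t j k := by rw [htexp]; positivity
        have h1 := Real.log_le_sub_one_of_pos (div_pos htp h)
        have h2 : Real.log (t j k / f j k) =
            L * sgnJ N J j k - Real.log (f j k / φ j k) := by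
          rw [Real.log_div htp.ne' h.ne', Real.log_div h.ne' hp.ne', htexp,
            Real.log_mul hp.ne' (Real.exp_pos _).ne', Real.log_exp]
          ring
        rw [h2] at h1
        have h3 := mul_le_mul_of_nonneg_left h1 h.le
        have h4 : f j k * (t j k / f j k - 1) = t j k - f j k := by field_simp
        rw [h4] at h3
        linarith
    have hs := Finset.sum_le_sum fun j (_ : j ∈ Finset.univ) =>
      Finset.sum_le_sum fun k (_ : k ∈ Finset.univ) => key j k
    simp only [Finset.sum_add_distrib, Finset.sum_sub_distrib, ← Finset.mul_sum] at hs
    have hdf := drift_eq Nb f J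
    rw [← hN] at hdf
    rw [hfsum, htsum, ← hdf] at hs
    unfold KLmat
    linarith
  · rw [EReal.top_div_of_pos_ne_top (by exact_mod_cast hfd) (EReal.coe_ne_top _)]
    exact le_top
end

section
/- Assume Assumptions 1 and 2, and let n := |V_S|. For α ∈ relint(Ω) define γ(α) := min_{J∈𝒥} (Σ_{i∈∂(J)} α_i) · log(λ_J/μ_J). Then vanilla MaxWeight loses at most a factor n: γ(n^{-1}·𝟙) ≥ (1/n) · sup_{α∈relint(Ω)} γ(α), where 𝟙 ∈ ℝ^{V_S} is the all-ones vector. -/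
open Finset

/-- Vanilla MaxWeight (uniform scaling `α = (1/n)·𝟙`) loses at most a factor `n = |V_S|`
of the optimal exponent `γ* = sup_{α ∈ relint Ω} γ(α)`, where
`γ(α) = min_{J ∈ 𝒥} (Σ_{i∈∂(J)} α_i) log(λ_J/μ_J)`. -/
theorem stmt_13 {VD VS : Type} [Fintype VD] [Fintype VS] [DecidableEq VD] [DecidableEq VS]
    (Nb : VD → Finset VS) (φ : VD → VS → ℝ)
    (hφ0 : ∀ j' k, 0 ≤ φ j' k) (hφsum : ∑ j' : VD, ∑ k : VS, φ j' k = 1)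
    (hA1 : ∃ j' k, k ∉ Nb j' ∧ 0 < φ j' k)
    (hA2 : ∀ J : Finset VD, J.Nonempty → J ⊂ Finset.univ →
      ∑ j' ∈ J, ∑ k : VS, φ j' k < ∑ i ∈ nbhd Nb J, ∑ j' : VD, φ j' i) :
    (1 / (Fintype.card VS : ℝ)) *
      sSup {y : ℝ | ∃ α : VS → ℝ, (∀ i, 0 < α i) ∧ (∑ i, α i = 1) ∧
        y = sInf {z : ℝ | ∃ J : Finset VD, J ⊂ Finset.univ ∧ 0 < muJ Nb φ J ∧
          z = (∑ i ∈ nbhd Nb J, α i) * Real.log (lamJ Nb φ J / muJ Nb φ J)}}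
    ≤ sInf {z : ℝ | ∃ J : Finset VD, J ⊂ Finset.univ ∧ 0 < muJ Nb φ J ∧
        z = (∑ i ∈ nbhd Nb J, (1 / (Fintype.card VS : ℝ))) *
          Real.log (lamJ Nb φ J / muJ Nb φ J)} := by
  have key : ∀ J : Finset VD, J ⊂ Finset.univ → 0 < muJ Nb φ J →
      (nbhd Nb J).Nonempty ∧ 0 < Real.log (lamJ Nb φ J / muJ Nb φ J) := by
    intro J hJ hmu
    have hne : J.Nonempty := by
      rw [Finset.nonempty_iff_ne_empty]
      rintro rfl
      simp [muJ] at hmu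
    have h := hA2 J hne hJ
    constructor
    · rw [Finset.nonempty_iff_ne_empty]
      intro he
      rw [he, Finset.sum_empty] at h
      exact absurd h (not_lt.mpr
        (Finset.sum_nonneg fun j _ => Finset.sum_nonneg fun k _ => hφ0 j k))
    · apply Real.log_pos
      rw [one_lt_div hmu]
      have e1 : ∑ j' ∈ J, ∑ k : VS, φ j' k
          = ∑ j' ∈ J, ∑ k ∈ nbhd Nb J, φ j' k + muJ Nb φ J := by
        unfold muJ
        rw [← Finset.sum_add_distrib]
        exact Finset.sum_congr rfl fun j _ => (Finset.sum_add_sum_compl _ _).symm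
      have e2 : ∑ i ∈ nbhd Nb J, ∑ j' : VD, φ j' i
          = ∑ j' ∈ J, ∑ k ∈ nbhd Nb J, φ j' k + lamJ Nb φ J := by
        unfold lamJ
        rw [Finset.sum_comm]
        exact (Finset.sum_add_sum_compl _ _).symm
      linarith
  obtain ⟨_, k0, _⟩ := hA1
  have hn : (0 : ℝ) < Fintype.card VS := by
    exact_mod_cast Fintype.card_pos_iff.mpr ⟨k0⟩
  by_cases hE : ∃ J : Finset VD, J ⊂ Finset.univ ∧ 0 < muJ Nb φ J
  · obtain ⟨J0, hJ0, hm0⟩ := hE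
    refine le_csInf ⟨_, J0, hJ0, hm0, rfl⟩ ?_
    rintro z ⟨J, hJ, hm, rfl⟩
    obtain ⟨hne, hlog⟩ := key J hJ hm
    have h1 : (1 / (Fintype.card VS : ℝ)) ≤ ∑ i ∈ nbhd Nb J, (1 / (Fintype.card VS : ℝ)) := by
      obtain ⟨i, hi⟩ := hne
      exact Finset.single_le_sum (f := fun _ : VS => (1 / (Fintype.card VS : ℝ)))
        (fun _ _ => by positivity) hi
    refine le_trans (mul_le_mul_of_nonneg_left ?_ (by positivity))
      (mul_le_mul_of_nonneg_right h1 hlog.le)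
    refine Real.sSup_le ?_ hlog.le
    rintro y ⟨α, hα, hs, rfl⟩
    refine le_trans (csInf_le ?_ ⟨J, hJ, hm, rfl⟩) ?_
    · refine ⟨0, ?_⟩
      rintro z ⟨K, hK, hmK, rfl⟩
      exact mul_nonneg (Finset.sum_nonneg fun i _ => (hα i).le) (key K hK hmK).2.le
    · have h2 : ∑ i ∈ nbhd Nb J, α i ≤ 1 := by
        rw [← hs]
        exact Finset.sum_le_sum_of_subset_of_nonneg (Finset.subset_univ _)
          fun i _ _ => (hα i).le
      exact mul_le_of_le_one_left hlog.le h2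
  · have hemp : ∀ α : VS → ℝ, {z : ℝ | ∃ J : Finset VD, J ⊂ Finset.univ ∧ 0 < muJ Nb φ J ∧
          z = (∑ i ∈ nbhd Nb J, α i) * Real.log (lamJ Nb φ J / muJ Nb φ J)} = ∅ := by
      intro α
      ext z
      simp only [Set.mem_ofPred_eq, Set.mem_empty_iff_false, iff_false]
      rintro ⟨J, hJ, hm, _⟩
      exact hE ⟨J, hJ, hm⟩
    rw [hemp (fun _ => 1 / (Fintype.card VS : ℝ)), Real.sInf_empty]
    refine mul_nonpos_of_nonneg_of_nonpos (by positivity) (Real.sSup_le ?_ le_rfl)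
    rintro y ⟨α, _, _, rfl⟩
    rw [hemp α, Real.sInf_empty]
end

section
/- For every feasible assignment history of horizon T and every J ⊆ V_D, the number of dropped demands with origin in J is bounded below by the flow balance inequality: #{t < T : o_t ∈ J and a_t = ∅} ≥ #{t < T : o_t ∈ J} − #{t < T : dst_t ∈ ∂(J)} − Σ_{i∈∂(J)} X₀(i). -/
open Finset

/-- Flow-balance lower bound on the number of dropped demands with origin in `J`:
for every feasible assignment history of horizon `T`,
`#{t<T : o_t ∈ J, a_t = ∅} ≥ #{t<T : o_t ∈ J} − #{t<T : dst_t ∈ ∂(J)} − Σ_{i∈∂(J)} X₀(i)`. -/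
theorem stmt_16 {VD VS : Type} [Fintype VS] [DecidableEq VS] [DecidableEq VD]
    (Nb : VD → Finset VS) (T : ℕ)
    (o : ℕ → VD) (dst : ℕ → VS) (a : ℕ → Option VS)
    (X₀ : VS → ℕ) (X : ℕ → VS → ℤ)
    (hX0 : ∀ i, X 0 i = X₀ i)
    (hrec : ∀ t i, X (t + 1) i = X t i +
      (match a t with
       | none => 0
       | some i0 => (if dst t = i then 1 else 0) - (if i0 = i then 1 else 0)))
    (hfeas : ∀ t < T, ∀ i, a t = some i → i ∈ Nb (o t) ∧ 1 ≤ X t i)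
    (J : Finset VD) :
    (((Finset.range T).filter (fun t => o t ∈ J)).card : ℤ)
      - (((Finset.range T).filter (fun t => dst t ∈ nbhd Nb J)).card : ℤ)
      - ∑ i ∈ nbhd Nb J, (X₀ i : ℤ)
    ≤ (((Finset.range T).filter (fun t => o t ∈ J ∧ a t = none)).card : ℤ) := by
  have hnn : ∀ t ≤ T, ∀ i, 0 ≤ X t i := by
    intro t
    induction t with
    | zero => intro _ i; rw [hX0]; positivity
    | succ t ih =>
      intro ht i
      have h0 := ih (by omega) i
      rw [hrec]
      rcases h : a t with _ | i0
      · simpa using h0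
      · have h1 := (hfeas t (by omega) i0 h).2
        dsimp only
        by_cases hi : i0 = i
        · subst hi
          split_ifs <;> linarith
        · rw [if_neg hi]
          split_ifs <;> linarith
  have key : ∀ t ≤ T,
      (((Finset.range t).filter (fun t => o t ∈ J)).card : ℤ)
      - (((Finset.range t).filter (fun t => dst t ∈ nbhd Nb J)).card : ℤ)
      - ∑ i ∈ nbhd Nb J, (X₀ i : ℤ) + ∑ i ∈ nbhd Nb J, X t i
    ≤ (((Finset.range t).filter (fun t => o t ∈ J ∧ a t = none)).card : ℤ) := by
    intro t
    induction t with
    | zero => intro _; simp [hX0]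
    | succ t ih =>
      intro ht
      have h0 := ih (by omega)
      have hc : ∀ (p : ℕ → Prop) [DecidablePred p],
          (((Finset.range (t + 1)).filter p).card : ℤ)
            = ((Finset.range t).filter p).card + if p t then 1 else 0 := by
        intro p _
        rw [Finset.range_add_one, Finset.filter_insert]
        split_ifs
        · rw [Finset.card_insert_of_notMem (by simp)]; push_cast; ring
        · simp
      rw [hc, hc, hc]
      simp only [hrec, Finset.sum_add_distrib]
      rcases h : a t with _ | i0
      · simp only [Finset.sum_const_zero, and_true]
        split_ifs <;> omega
      · have h1 := (hfeas t (by omega) i0 h).1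
        have h2 : o t ∈ J → i0 ∈ nbhd Nb J := fun ho =>
          Finset.mem_biUnion.mpr ⟨_, ho, h1⟩
        simp only [Finset.sum_sub_distrib, Finset.sum_ite_eq, reduceCtorEq, and_false, if_false]
        by_cases ho : o t ∈ J
        · simp only [ho, h2 ho, if_true]
          split_ifs <;> linarith
        · simp only [ho, if_false]
          split_ifs <;> linarith
  have h1 := key T le_rfl
  have h2 : 0 ≤ ∑ i ∈ nbhd Nb J, X T i := Finset.sum_nonneg fun i _ => hnn T le_rfl i
  linarith
end
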